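/- Let Z be a finite type, let q : Z → ℝ be a probability mass function (q z ≥ 0 for all z and ∑_z q z = 1), let Q ⊆ Z be a set with C := ∑_{z ∈ Q} q z satisfying 0 < C, and let ε > 0. Define the true posterior p(z) = q z / C for z ∈ Q and p(z) = 0 otherwise, and the smoothed posterior p'(z) = (𝟙[z ∈ Q] + ε) · q z / (C + ε). Then the Kullback–Leibler divergence KL(p ‖ p') = ∑_z p(z) · log(p(z)/p'(z)) equals log(1 + ε/C) − log(1 + ε). -/

import Mathlib

/-- The KL divergence of the smoothed posterior `p'` from the true posterior `p`
equals `log(1 + ε/C) − log(1 + ε)`. -/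
theorem kl_true_smoothed_posterior {Z : Type*} [Fintype Z] [DecidableEq Z]
    (q : Z → ℝ) (hq0 : ∀ z, 0 ≤ q z) (hq1 : ∑ z, q z = 1)
    (Q : Finset Z) (C : ℝ) (hC : C = ∑ z ∈ Q, q z) (hCpos : 0 < C)
    (ε : ℝ) (hε : 0 < ε)
    (p p' : Z → ℝ)
    (hp : ∀ z, p z = if z ∈ Q then q z / C else 0)
    (hp' : ∀ z, p' z = ((if z ∈ Q then (1 : ℝ) else 0) + ε) * q z / (C + ε)) :
    ∑ z, p z * Real.log (p z / p' z)
      = Real.log (1 + ε / C) - Real.log (1 + ε) := by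
  have hterm : ∀ z, p z * Real.log (p z / p' z)
      = p z * (Real.log (1 + ε / C) - Real.log (1 + ε)) := by
    intro z
    by_cases hz : z ∈ Q
    · rcases eq_or_ne (q z) 0 with h0 | h0
      · simp [hp, h0]
      · have hratio : p z / p' z = (1 + ε / C) / (1 + ε) := by
          have h1 : C + ε ≠ 0 := by positivity
          have h2 : 1 + ε ≠ 0 := by positivity
          rw [hp, hp', if_pos hz, if_pos hz]
          field_simp
        rw [hratio, Real.log_div (by positivity) (by positivity)]
    · simp [hp, hz]
  have hsum : ∑ z, p z = 1 := by
    simp only [hp, Finset.sum_ite_mem, Finset.univ_inter]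
    rw [← Finset.sum_div, ← hC, div_self hCpos.ne']
  rw [Finset.sum_congr rfl fun z _ => hterm z, ← Finset.sum_mul, hsum, one_mul]
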